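/- The encoding ⟦·⟧ᵐₐ preserves requests: for all target terms T₁, T₂ of ⟦·⟧ᵐₐ with T₁ ⟹ T₂, if T₁ is structurally congruent to (νx̃)(T₁' | pᵢ⟨y,l,r⟩) for some unguarded input request, then T₂ is structurally congruent to (νx̃')(T₂' | pᵢ'⟨y,l,r⟩) for some request channel pᵢ' carrying the same three values; and analogously, every unguarded output request pₒ⟨y,l,s,z⟩ of T₁ persists in T₂ as an output request on some channel with the same four values. -/

import Mathlib

set_option autoImplicit true
set_option relaxedAutoImplicit true
set_option maxHeartbeats 1000000

namespace PiCalc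

/-! # The π-calculi πₘ (mixed choice), πₛ (separate choice) and πₐ (asynchronous)

Formalization of the setting of Peters/Nestmann, "On the Expressiveness of Mixed Choice"
(technical report).  Names are natural numbers; a single syntax covers all three calculi,
with subcalculi carved out by predicates.  Sums are built from the empty sum `nil`,
guarded terms and binary `choice`. -/

abbrev Name : Type := ℕ

inductive Proc : Type
  | nil : Proc                               -- empty sum 0
  | succ : Proc                              -- success ✓
  | res : Name → Proc → Proc                 -- (νx)P
  | par : Proc → Proc → Proc                 -- P | Q
  | mat : Name → Name → Proc → Proc          -- [a = b]P
  | inp : Name → List Name → Proc → Proc     -- y(x̃).P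
  | out : Name → List Name → Proc → Proc     -- ȳ⟨z̃⟩.P  (asynchronous output: continuation nil)
  | rep : Name → List Name → Proc → Proc     -- y*(x̃).P (replicated input)
  | tau : Proc → Proc                        -- τ.P
  | choice : Proc → Proc → Proc              -- P + Q
  deriving DecidableEq

/-- Free names of a process. -/
def freeNames : Proc → Finset Name
  | .nil => ∅
  | .succ => ∅
  | .res x P => freeNames P \ {x}
  | .par P Q => freeNames P ∪ freeNames Q
  | .mat a b P => insert a (insert b (freeNames P))
  | .inp y xs P => insert y (freeNames P \ xs.toFinset)
  | .out y zs P => insert y (zs.toFinset ∪ freeNames P)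
  | .rep y xs P => insert y (freeNames P \ xs.toFinset)
  | .tau P => freeNames P
  | .choice P Q => freeNames P ∪ freeNames Q

/-- All names (free or bound) occurring in a process. -/
def allNames : Proc → Finset Name
  | .nil => ∅
  | .succ => ∅
  | .res x P => insert x (allNames P)
  | .par P Q => allNames P ∪ allNames Q
  | .mat a b P => insert a (insert b (allNames P))
  | .inp y xs P => insert y (xs.toFinset ∪ allNames P)
  | .out y zs P => insert y (zs.toFinset ∪ allNames P)
  | .rep y xs P => insert y (xs.toFinset ∪ allNames P)
  | .tau P => allNames P
  | .choice P Q => allNames P ∪ allNames Q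

/-! ## Alpha-equivalence, via a de Bruijn normal form -/

inductive DBName : Type
  | free : Name → DBName
  | bound : ℕ → DBName
  deriving DecidableEq

inductive DB : Type
  | nil : DB
  | succ : DB
  | res : DB → DB
  | par : DB → DB → DB
  | mat : DBName → DBName → DB → DB
  | inp : DBName → ℕ → DB → DB
  | out : DBName → List DBName → DB → DB
  | rep : DBName → ℕ → DB → DB
  | tau : DB → DB
  | choice : DB → DB → DB
  deriving DecidableEq

def dbVar (env : List Name) (x : Name) : DBName :=
  match env.findIdx? (· == x) with
  | some i => .bound i
  | none => .free x

def toDB : List Name → Proc → DB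
  | _, .nil => .nil
  | _, .succ => .succ
  | env, .res x P => .res (toDB (x :: env) P)
  | env, .par P Q => .par (toDB env P) (toDB env Q)
  | env, .mat a b P => .mat (dbVar env a) (dbVar env b) (toDB env P)
  | env, .inp y xs P => .inp (dbVar env y) xs.length (toDB (xs.reverse ++ env) P)
  | env, .out y zs P => .out (dbVar env y) (zs.map (dbVar env)) (toDB env P)
  | env, .rep y xs P => .rep (dbVar env y) xs.length (toDB (xs.reverse ++ env) P)
  | env, .tau P => .tau (toDB env P)
  | env, .choice P Q => .choice (toDB env P) (toDB env Q)

/-- `P` and `Q` are alpha-equivalent (differ only in the choice of bound names). -/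
def AlphaEq (P Q : Proc) : Prop := toDB [] P = toDB [] Q

/-! ## Capture-avoiding substitution -/

def freshName (avoid : Finset Name) : Name := avoid.sup id + 1

def freshNames : Finset Name → ℕ → List Name
  | _, 0 => []
  | avoid, n + 1 => freshName avoid :: freshNames (insert (freshName avoid) avoid) n

/-- Simultaneous update of a substitution on lists of names. -/
def updates (σ : Name → Name) : List Name → List Name → Name → Name
  | x :: xs, z :: zs => Function.update (updates σ xs zs) x z
  | _, _ => σ

def applySubstAux : (Name → Name) → Finset Name → Proc → Proc
  | _, _, .nil => .nil
  | _, _, .succ => .succ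
  | σ, avoid, .res x P =>
      let x' := freshName avoid
      .res x' (applySubstAux (Function.update σ x x') (insert x' avoid) P)
  | σ, avoid, .par P Q => .par (applySubstAux σ avoid P) (applySubstAux σ avoid Q)
  | σ, avoid, .mat a b P => .mat (σ a) (σ b) (applySubstAux σ avoid P)
  | σ, avoid, .inp y xs P =>
      let xs' := freshNames avoid xs.length
      .inp (σ y) xs' (applySubstAux (updates σ xs xs') (avoid ∪ xs'.toFinset) P)
  | σ, avoid, .out y zs P => .out (σ y) (zs.map σ) (applySubstAux σ avoid P)
  | σ, avoid, .rep y xs P =>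
      let xs' := freshNames avoid xs.length
      .rep (σ y) xs' (applySubstAux (updates σ xs xs') (avoid ∪ xs'.toFinset) P)
  | σ, avoid, .tau P => .tau (applySubstAux σ avoid P)
  | σ, avoid, .choice P Q => .choice (applySubstAux σ avoid P) (applySubstAux σ avoid Q)

/-- Application `σ(P)` of a substitution to a process, silently alpha-converting
all binders to avoid capture and name clashes. -/
def applySubst (σ : Name → Name) (P : Proc) : Proc :=
  applySubstAux σ (allNames P ∪ (allNames P).image σ) P

/-- For an injective renaming policy `φ`, the substitution
`φ(σ) = {φ(y₁)/φ(x₁), …, φ(yₙ)/φ(xₙ)}` induced by `σ = {y₁/x₁, …, yₙ/xₙ}`. -/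
noncomputable def mapSubst (φ σ : Name → Name) : Name → Name :=
  fun m =>
    letI := Classical.propDecidable (∃ n, φ n = m)
    if h : ∃ n, φ n = m then φ (σ (Classical.choose h)) else m

def resList : List Name → Proc → Proc
  | [], P => P
  | x :: xs, P => .res x (resList xs P)

def parList : List Proc → Proc
  | [] => .nil
  | [P] => P
  | P :: Ps => .par P (parList Ps)

/-! ## Structural congruence (Figure 1); the flag `true` additionally allows
splitting of replicated inputs (`≡ᵣₑₚ`). -/

inductive StructCongX : Bool → Proc → Proc → Prop
  | alpha {b : Bool} {P Q : Proc} : AlphaEq P Q → StructCongX b P Q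
  | parNil {b : Bool} {P : Proc} : StructCongX b (.par P .nil) P
  | parComm {b : Bool} {P Q : Proc} : StructCongX b (.par P Q) (.par Q P)
  | parAssoc {b : Bool} {P Q R : Proc} :
      StructCongX b (.par P (.par Q R)) (.par (.par P Q) R)
  | matElim {b : Bool} {a : Name} {P : Proc} : StructCongX b (.mat a a P) P
  | resNil {b : Bool} {n : Name} : StructCongX b (.res n .nil) .nil
  | resSwap {b : Bool} {n m : Name} {P : Proc} :
      StructCongX b (.res n (.res m P)) (.res m (.res n P))
  | resPar {b : Bool} {n : Name} {P Q : Proc} :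
      n ∉ freeNames P → StructCongX b (.par P (.res n Q)) (.res n (.par P Q))
  | repSplit {y : Name} {xs : List Name} {P : Proc} :
      StructCongX true (.rep y xs P) (.par (.rep y xs P) (.rep y xs P))
  | refl {b : Bool} {P : Proc} : StructCongX b P P
  | symm {b : Bool} {P Q : Proc} : StructCongX b P Q → StructCongX b Q P
  | trans {b : Bool} {P Q R : Proc} :
      StructCongX b P Q → StructCongX b Q R → StructCongX b P R
  | resCong {b : Bool} {x : Name} {P Q : Proc} :
      StructCongX b P Q → StructCongX b (.res x P) (.res x Q)
  | parCong {b : Bool} {P P' Q Q' : Proc} :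
      StructCongX b P P' → StructCongX b Q Q' → StructCongX b (.par P Q) (.par P' Q')

/-- Structural congruence `≡`. -/
abbrev StructCong : Proc → Proc → Prop := StructCongX false
/-- Structural congruence `≡ᵣₑₚ` extended by `y*(x̃).P ≡ y*(x̃).P | y*(x̃).P`. -/
abbrev StructCongRep : Proc → Proc → Prop := StructCongX true

/-! ## Reduction semantics (Figure 2 of the preliminaries) -/

/-- `IsSummand G S`: the (guarded) term `G` occurs as a summand of the sum `S`. -/
inductive IsSummand : Proc → Proc → Prop
  | refl (P : Proc) : IsSummand P P
  | left {P Q R : Proc} : IsSummand P Q → IsSummand P (.choice Q R)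
  | right {P Q R : Proc} : IsSummand P R → IsSummand P (.choice Q R)

/-- Labelled reduction: the label records the channel of the interaction
(`none` for a step of a τ-guarded summand). -/
inductive LabStep : Proc → Option Name → Proc → Prop
  | tauStep {P S : Proc} : IsSummand (.tau P) S → LabStep S none P
  | com {y : Name} {xs zs : List Name} {P Q S₁ S₂ : Proc} :
      xs.length = zs.length →
      IsSummand (.inp y xs P) S₁ → IsSummand (.out y zs Q) S₂ →
      LabStep (.par S₁ S₂) (some y) (.par (applySubst (updates id xs zs) P) Q)
  | repStep {y : Name} {xs zs : List Name} {P Q S : Proc} :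
      xs.length = zs.length →
      IsSummand (.out y zs Q) S →
      LabStep (.par (.rep y xs P) S) (some y)
        (.par (applySubst (updates id xs zs) P) (.par Q (.rep y xs P)))
  | parStep {P P' Q : Proc} {a : Option Name} :
      LabStep P a P' → LabStep (.par P Q) a (.par P' Q)
  | resStep {P P' : Proc} {x : Name} {a : Option Name} :
      LabStep P a P' → LabStep (.res x P) a (.res x P')
  | congr {P P' Q Q' : Proc} {a : Option Name} :
      StructCong P P' → LabStep P' a Q' → StructCong Q' Q → LabStep P a Q

/-- One reduction step `P ⟶ Q`. -/
def Reduces (P Q : Proc) : Prop := ∃ a, LabStep P a Q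

/-- `P ⟹ Q`: reflexive-transitive closure of reduction. -/
def Steps : Proc → Proc → Prop := Relation.ReflTransGen Reduces

/-- `P ⟶^ω`: `P` has an infinite sequence of reduction steps. -/
def Divergent (P : Proc) : Prop := ∃ f : ℕ → Proc, f 0 = P ∧ ∀ n, Reduces (f n) (f (n + 1))

/-- `P ⇓✓`: `P` may lead to success. -/
def reachSuccess (P : Proc) : Prop :=
  ∃ P' P'' : Proc, Steps P P' ∧ StructCong P' (.par P'' .succ)

/-! ## The subcalculi -/

mutual
  /-- `P` is a term of the π-calculus with mixed choice πₘ. -/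
  inductive IsMix : Proc → Prop
    | succ : IsMix .succ
    | res {x : Name} {P : Proc} : IsMix P → IsMix (.res x P)
    | par {P Q : Proc} : IsMix P → IsMix Q → IsMix (.par P Q)
    | mat {a c : Name} {P : Proc} : IsMix P → IsMix (.mat a c P)
    | rep {y x : Name} {P : Proc} : IsMix P → IsMix (.rep y [x] P)
    | sum {P : Proc} : IsMixSum P → IsMix P
  /-- `P` is a (possibly empty) mixed-choice sum of guarded πₘ terms. -/
  inductive IsMixSum : Proc → Prop
    | nil : IsMixSum .nil
    | inp {y x : Name} {P : Proc} : IsMix P → IsMixSum (.inp y [x] P)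
    | out {y z : Name} {P : Proc} : IsMix P → IsMixSum (.out y [z] P)
    | tau {P : Proc} : IsMix P → IsMixSum (.tau P)
    | choice {P Q : Proc} : IsMixSum P → IsMixSum Q → IsMixSum (.choice P Q)
end

mutual
  /-- `P` is a term of the π-calculus with separate choice πₛ. -/
  inductive IsSep : Proc → Prop
    | succ : IsSep .succ
    | res {x : Name} {P : Proc} : IsSep P → IsSep (.res x P)
    | par {P Q : Proc} : IsSep P → IsSep Q → IsSep (.par P Q)
    | mat {a c : Name} {P : Proc} : IsSep P → IsSep (.mat a c P)
    | rep {y x : Name} {P : Proc} : IsSep P → IsSep (.rep y [x] P)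
    | sumIn {P : Proc} : IsSepIn P → IsSep P
    | sumOut {P : Proc} : IsSepOut P → IsSep P
  /-- a sum all of whose guards are inputs or τ -/
  inductive IsSepIn : Proc → Prop
    | nil : IsSepIn .nil
    | inp {y x : Name} {P : Proc} : IsSep P → IsSepIn (.inp y [x] P)
    | tau {P : Proc} : IsSep P → IsSepIn (.tau P)
    | choice {P Q : Proc} : IsSepIn P → IsSepIn Q → IsSepIn (.choice P Q)
  /-- a sum all of whose guards are outputs or τ -/
  inductive IsSepOut : Proc → Prop
    | nil : IsSepOut .nil
    | out {y z : Name} {P : Proc} : IsSep P → IsSepOut (.out y [z] P)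
    | tau {P : Proc} : IsSep P → IsSepOut (.tau P)
    | choice {P Q : Proc} : IsSepOut P → IsSepOut Q → IsSepOut (.choice P Q)
end

/-- `P` is a term of the (polyadic) asynchronous π-calculus πₐ. -/
inductive IsAsync : Proc → Prop
  | nil : IsAsync .nil
  | succ : IsAsync .succ
  | res {x : Name} {P : Proc} : IsAsync P → IsAsync (.res x P)
  | par {P Q : Proc} : IsAsync P → IsAsync Q → IsAsync (.par P Q)
  | mat {a c : Name} {P : Proc} : IsAsync P → IsAsync (.mat a c P)
  | out {y : Name} {zs : List Name} : IsAsync (.out y zs .nil)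
  | inp {y : Name} {xs : List Name} {P : Proc} : IsAsync P → IsAsync (.inp y xs P)
  | tau {P : Proc} : IsAsync P → IsAsync (.tau P)
  | rep {y : Name} {xs : List Name} {P : Proc} : IsAsync P → IsAsync (.rep y xs P)

/-- A guarded πₘ term `π.P` (a potential summand). -/
def IsGuardedMix (g : Proc) : Prop :=
  match g with
  | .inp _ [_] P => IsMix P
  | .out _ [_] P => IsMix P
  | .tau P => IsMix P
  | _ => False

/-- A guarded πₛ term `π.P` (a potential summand). -/
def IsGuardedSep (g : Proc) : Prop :=
  match g with
  | .inp _ [_] P => IsSep P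
  | .out _ [_] P => IsSep P
  | .tau P => IsSep P
  | _ => False

/-! ## Reserved names, booleans and test-statements -/

def nT : Name := 0      -- t
def nF : Name := 1      -- f
def nL : Name := 2      -- sum lock l
def nL' : Name := 3     -- sum lock l'
def nS : Name := 4      -- sender lock s
def nR : Name := 5      -- receiver lock r
def nPo : Name := 6     -- request channel p_o
def nPi : Name := 7     -- request channel p_i
def nMo : Name := 8     -- m_o
def nMi : Name := 9     -- m_i
def nCo : Name := 10    -- c_o
def nCi : Name := 11    -- c_i
def nCmo : Name := 12   -- c_{m,o}
def nCmi : Name := 13   -- c_{m,i}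
def nMuo : Name := 14   -- m_{up,o}
def nMui : Name := 15   -- m_{up,i}
def nLs : Name := 16    -- l_s
def nLr : Name := 17    -- l_r
def nL1 : Name := 18    -- l₁
def nL2 : Name := 19    -- l₂
def nCr1 : Name := 20   -- c_{r,1}
def nCr2 : Name := 21   -- c_{r,2}
def nMri : Name := 22   -- m_{r,i}
def nMro : Name := 23   -- m_{r,o}
def nMrui : Name := 24  -- m_{r,up,i}
def nMruo : Name := 25  -- m_{r,up,o}
def nY : Name := 26     -- y
def nY' : Name := 27    -- y'
def nZ : Name := 28     -- z
def nDash : Name := 29  -- the wildcard "−"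
def argBase : Name := 30

/-- The renaming policy φˢₐ: an injective substitution translating every source term
name into a single name different from all reserved names. -/
def phiSA : Name → Name := fun n => n + 50

/-- The renaming policy φᵐₐ. -/
def phiMA : Name → Name := fun n => n + 50

/-- Boolean instantiation `l⟨⊤⟩ ≜ l(t,f).t̄`. -/
def lockTrue (l : Name) : Proc := .inp l [nT, nF] (.out nT [] .nil)

/-- Boolean instantiation `l⟨⊥⟩ ≜ l(t,f).f̄`. -/
def lockFalse (l : Name) : Proc := .inp l [nT, nF] (.out nF [] .nil)

/-- `l⟨b⟩` for a boolean value `b`. -/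
def lockOut (l : Name) (b : Bool) : Proc := if b then lockTrue l else lockFalse l

/-- `test l then P else Q ≜ (νt,f)(l⟨t,f⟩ | t.P | f.Q)`. -/
def test (l : Name) (P Q : Proc) : Proc :=
  .res nT (.res nF (.par (.out l [nT, nF] .nil) (.par (.inp nT [] P) (.inp nF [] Q))))

/-- reserved argument names for forwarders -/
def fwArgs (n : ℕ) : List Name := (List.range n).map (fun i => argBase + i)

/-- Forwarder `y ↠ {y₁, …, yₖ}` for channels of multiplicity `n`. -/
def forward (y : Name) (ys : List Name) (n : ℕ) : Proc :=
  .rep y (fwArgs n) (parList (ys.map fun yi => .out yi (fwArgs n) .nil))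

/-! ## The encoding ⟦·⟧ˢₐ of πₛ into πₐ (Figure 2 / Nestmann) -/

/-- Computes simultaneously the translation of a term and (for potential summands)
the translation of the summand as a function of the surrounding sum lock. -/
def encSAcore : Proc → Proc × (Name → Proc)
  | .nil => (.res nL (.par (lockTrue nL) .nil), fun _ => .nil)
  | .succ => (.succ, fun _ => .nil)
  | .res x P => (.res (phiSA x) (encSAcore P).1, fun _ => .nil)
  | .par P Q => (.par (encSAcore P).1 (encSAcore Q).1, fun _ => .nil)
  | .mat a b P => (.mat (phiSA a) (phiSA b) (encSAcore P).1, fun _ => .nil)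
  | .rep y xs P =>
      (.rep (phiSA y) ([nL, nS] ++ xs.map phiSA)
          (test nL (.par (lockFalse nL) (.par (.out nS [] .nil) (encSAcore P).1))
            (lockFalse nL)),
       fun _ => .nil)
  | .tau P =>
      let e := (encSAcore P).1
      let s := fun l => test l (.par (lockFalse l) e) (lockFalse l)
      (.res nL (.par (lockTrue nL) (s nL)), s)
  | .out y zs P =>
      let e := (encSAcore P).1
      let s := fun l =>
        .res nS (.par (.out (phiSA y) ([l, nS] ++ zs.map phiSA) .nil) (.inp nS [] e))
      (.res nL (.par (lockTrue nL) (s nL)), s)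
  | .inp y xs P =>
      let e := (encSAcore P).1
      let s := fun l =>
        .res nR (.par (.out nR [] .nil)
          (.rep nR []
            (.inp (phiSA y) ([nL', nS] ++ xs.map phiSA)
              (test l
                (test nL'
                  (.par (lockFalse l)
                    (.par (lockFalse nL') (.par (.out nS [] .nil) e)))
                  (.par (lockTrue l) (.par (lockFalse nL') (.out nR [] .nil))))
                (.par (lockFalse l)
                  (.out (phiSA y) ([nL', nS] ++ xs.map phiSA) .nil))))))
      (.res nL (.par (lockTrue nL) (s nL)), s)
  | .choice P Q =>
      let a := (encSAcore P).2
      let b := (encSAcore Q).2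
      (.res nL (.par (lockTrue nL) (.par (a nL) (b nL))), fun l => .par (a l) (b l))

/-- The encoding `⟦·⟧ˢₐ` from πₛ into πₐ. -/
def encSA (P : Proc) : Proc := (encSAcore P).1

/-- `⟦π.P⟧ˢₐ` of a summand, with `l` as the sum lock of the surrounding sum. -/
def encSASummand (l : Name) (g : Proc) : Proc := (encSAcore g).2 l

/-! ## The encoding ⟦·⟧ᵐₐ of πₘ into πₐ (Figure 3) -/

/-- processing of right output requests in the parallel-operator encoding -/
def procRightOut : Proc :=
  .par (.out nCmo [nMi] .nil)
    (.rep nCmo [nMi]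
      (.inp nPo [nY, nLs, nS, nZ]
        (.par
          (.res nMui
            (.par
              (.rep nMi [nY', nLr, nR]
                (.par (.mat nY' nY (.out nR [nLr, nLs, nLs, nS, nZ] .nil))
                      (.out nMui [nY', nLr, nR] .nil)))
              (.res nMi (.par (forward nMui [nMi] 3) (.out nCmo [nMi] .nil)))))
          (.out nCo [nY, nLs, nS, nZ] .nil))))

/-- processing of right input requests in the parallel-operator encoding -/
def procRightIn : Proc :=
  .par (.out nCmi [nMo] .nil)
    (.rep nCmi [nMo]
      (.inp nPi [nY, nLr, nR]
        (.par
          (.res nMuo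
            (.par
              (.rep nMo [nY', nLs, nS, nZ]
                (.par (.mat nY' nY (.out nR [nLs, nLr, nLs, nS, nZ] .nil))
                      (.out nMuo [nY', nLs, nS, nZ] .nil)))
              (.res nMo (.par (forward nMuo [nMo] 4) (.out nCmi [nMo] .nil)))))
          (.out nCi [nY, nLr, nR] .nil))))

def procLeftOut : Proc := forward nPo [nMo, nCo] 4
def procLeftIn : Proc := forward nPi [nMi, nCi] 3
def pushReqs : Proc := .par (forward nCo [nPo] 4) (forward nCi [nPi] 3)

/-- The context introduced by `⟦P | Q⟧ᵐₐ` around `⟦P⟧ᵐₐ` and `⟦Q⟧ᵐₐ`. -/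
def encMApar (EP EQ : Proc) : Proc :=
  resList [nMo, nMi, nCo, nCi, nCmo, nCmi]
    (parList
      [ .res nPo (.res nPi (parList [EP, procLeftOut, procLeftIn]))
      , .res nPo (.res nPi (parList [EQ, procRightOut, procRightIn]))
      , pushReqs ])

def pushReqsIn : Proc :=
  .par (forward nMro [nMo, nMruo] 4) (forward nMri [nMi, nMrui] 3)

def pushReqsOut : Proc :=
  parList
    [ .out nCr2 [nMro, nMri] .nil
    , forward nCo [nPo, nMro] 4
    , forward nMruo [nMro] 4
    , forward nCi [nPi, nMri] 3
    , forward nMrui [nMri] 3 ]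

/-- A branch of the replicated-input encoding around the encoded continuation `e`. -/
def encMAbranch (e : Proc) : Proc :=
  resList [nMo, nMi, nCo, nCi, nMruo, nMrui, nCmo, nCmi, nMuo, nMui]
    (parList
      [ pushReqsIn
      , .res nPo (.res nPi (parList [e, procRightOut, procRightIn]))
      , .res nMro (.res nMri pushReqsOut) ])

/-- `⟦y*(x).P⟧ᵐₐ`; here `y` and `pxs` are already translated by φᵐₐ and
`e` is the translation of the continuation. -/
def encMArep (y : Name) (pxs : List Name) (e : Proc) : Proc :=
  resList [nL, nR, nCr1, nCr2, nMro, nMri]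
    (parList
      [ .out nPi [y, nL, nR] .nil
      , .rep nR ([nDash, nDash, nLs, nS] ++ pxs)
          (test nLs
            (.par (lockFalse nLs) (.par (.out nS [] .nil) (.out nCr1 pxs .nil)))
            (lockFalse nLs))
      , .out nMri [y, nL, nR] .nil
      , lockTrue nL
      , .out nCr2 [nMro, nMri] .nil
      , .rep nCr1 pxs (.inp nCr2 [nMro, nMri] (encMAbranch e)) ])

def encMAcore : Proc → Proc × (Name → Proc)
  | .nil => (.res nL (.par (lockTrue nL) .nil), fun _ => .nil)
  | .succ => (.succ, fun _ => .nil)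
  | .res x P => (.res (phiMA x) (encMAcore P).1, fun _ => .nil)
  | .par P Q => (encMApar (encMAcore P).1 (encMAcore Q).1, fun _ => .nil)
  | .mat a b P => (.mat (phiMA a) (phiMA b) (encMAcore P).1, fun _ => .nil)
  | .rep y xs P => (encMArep (phiMA y) (xs.map phiMA) (encMAcore P).1, fun _ => .nil)
  | .tau P =>
      let e := (encMAcore P).1
      let s := fun l => test l (.par (lockFalse l) e) (lockFalse l)
      (.res nL (.par (lockTrue nL) (s nL)), s)
  | .out y zs P =>
      let e := (encMAcore P).1
      let s := fun l =>
        .res nS (.par (.out nPo ([phiMA y, l, nS] ++ zs.map phiMA) .nil) (.inp nS [] e))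
      (.res nL (.par (lockTrue nL) (s nL)), s)
  | .inp y xs P =>
      let e := (encMAcore P).1
      let s := fun l =>
        .res nR (.par (.out nPi [phiMA y, l, nR] .nil)
          (.rep nR ([nL1, nL2, nDash, nS] ++ xs.map phiMA)
            (test nL1
              (test nL2
                (.par (lockFalse nL1)
                  (.par (lockFalse nL2) (.par (.out nS [] .nil) e)))
                (.par (lockTrue nL1) (lockFalse nL2)))
              (lockFalse nL1))))
      (.res nL (.par (lockTrue nL) (s nL)), s)
  | .choice P Q =>
      let a := (encMAcore P).2
      let b := (encMAcore Q).2
      (.res nL (.par (lockTrue nL) (.par (a nL) (b nL))), fun l => .par (a l) (b l))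

/-- The encoding `⟦·⟧ᵐₐ` from πₘ into πₐ. -/
def encMA (P : Proc) : Proc := (encMAcore P).1

/-- `⟦π.P⟧ᵐₐ` of a summand, with `l` as the sum lock of the surrounding sum. -/
def encMASummand (l : Name) (g : Proc) : Proc := (encMAcore g).2 l

/-! ## Target terms, requests and sum locks -/

/-- Target terms of `⟦·⟧ˢₐ`: encodings of πₛ terms and their derivatives. -/
def TargetSA (T : Proc) : Prop :=
  ∃ S : Proc, IsSep S ∧ (StructCong T (encSA S) ∨ Steps (encSA S) T)

/-- Target terms of `⟦·⟧ᵐₐ`: encodings of πₘ terms and their derivatives. -/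
def TargetMA (T : Proc) : Prop :=
  ∃ S : Proc, IsMix S ∧ (StructCong T (encMA S) ∨ Steps (encMA S) T)

/-- `T` contains an unguarded input request `p̄⟨y, l, r⟩` (an output with three
parameters), i.e. `T ≡ (νx̃)(T' ∣ p̄⟨y,l,r⟩)`. -/
def hasInputRequest (T : Proc) (p y l r : Name) : Prop :=
  ∃ (xs : List Name) (T' : Proc),
    StructCong T (resList xs (.par T' (.out p [y, l, r] .nil)))

/-- `T` contains an unguarded output request `p̄⟨y, l, s, z⟩` (an output with four
parameters), i.e. `T ≡ (νx̃)(T' ∣ p̄⟨y,l,s,z⟩)`. -/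
def hasOutputRequest (T : Proc) (p y l s z : Name) : Prop :=
  ∃ (xs : List Name) (T' : Proc),
    StructCong T (resList xs (.par T' (.out p [y, l, s, z] .nil)))

/-- `T` uses the name `l` as a link (subject of an input, output or replicated input)
with multiplicity `n`. -/
def usesLink : Proc → Name → ℕ → Prop
  | .nil, _, _ => False
  | .succ, _, _ => False
  | .res x P, l, n => l ≠ x ∧ usesLink P l n
  | .par P Q, l, n => usesLink P l n ∨ usesLink Q l n
  | .mat _ _ P, l, n => usesLink P l n
  | .inp y xs P, l, n => (y = l ∧ xs.length = n) ∨ (l ∉ xs ∧ usesLink P l n)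
  | .out y zs P, l, n => (y = l ∧ zs.length = n) ∨ usesLink P l n
  | .rep y xs P, l, n => (y = l ∧ xs.length = n) ∨ (l ∉ xs ∧ usesLink P l n)
  | .tau P, l, n => usesLink P l n
  | .choice P Q, l, n => usesLink P l n ∨ usesLink Q l n

/-- `T` contains an output on the link `l` carrying exactly the values `zs`. -/
def outputsOn : Proc → Name → List Name → Prop
  | .nil, _, _ => False
  | .succ, _, _ => False
  | .res x P, l, zs => l ≠ x ∧ outputsOn P l zs
  | .par P Q, l, zs => outputsOn P l zs ∨ outputsOn Q l zs
  | .mat _ _ P, l, zs => outputsOn P l zs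
  | .inp _ xs P, l, zs => l ∉ xs ∧ outputsOn P l zs
  | .out y zs' P, l, zs => (y = l ∧ zs' = zs) ∨ outputsOn P l zs
  | .rep _ xs P, l, zs => l ∉ xs ∧ outputsOn P l zs
  | .tau P, l, zs => outputsOn P l zs
  | .choice P Q, l, zs => outputsOn P l zs ∨ outputsOn Q l zs

/-- `l` is a sum lock of `T` (Definition 14): `l` is used in `T` as a link with
multiplicity two, carrying two links with multiplicity zero. -/
def IsSumLock (T : Proc) (l : Name) : Prop :=
  usesLink T l 2 ∧ (∀ n, usesLink T l n → n = 2) ∧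
  (∀ zs, outputsOn T l zs → ∀ z ∈ zs, ∀ n, usesLink T z n → n = 0)

/-! ## Translated observables (Definition 24) -/

/-- Observables/barbs: input or output on a (source-term) name. -/
inductive Barb : Type
  | inp : Name → Barb
  | out : Name → Barb

/-- Translated observables of `⟦·⟧ˢₐ`. -/
def transBarbSA : Proc → Barb → Prop
  | T, .inp y =>
      ∃ (xs : List Name) (T' T₁ T₂ : Proc) (l l' s z : Name),
        y ∉ xs ∧
        (StructCong T
            (resList xs (.par T' (.par (.inp y [l', s, z] (test l T₁ T₂)) (lockTrue l)))) ∨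
          ∃ B : Proc, StructCong T (resList xs (.par T' (.rep y [l', s, z] B))))
  | T, .out y =>
      ∃ (xs : List Name) (T' : Proc) (l s z : Name),
        y ∉ xs ∧
        StructCong T (resList xs (.par T' (.par (.out y [l, s, z] .nil) (lockTrue l))))

/-- Translated observables of `⟦·⟧ᵐₐ`. -/
def transBarbMA : Proc → Barb → Prop
  | T, .inp y =>
      ∃ (xs : List Name) (T' : Proc) (p l r : Name),
        y ∉ xs ∧
        StructCong T (resList xs (.par T' (.par (.out p [y, l, r] .nil) (lockTrue l))))
  | T, .out y =>
      ∃ (xs : List Name) (T' : Proc) (p l s z : Name),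
        y ∉ xs ∧
        StructCong T (resList xs (.par T' (.par (.out p [y, l, s, z] .nil) (lockTrue l))))

/-- weak (reachable) translated observables -/
def weakBarb (barb : Proc → Barb → Prop) (P : Proc) (μ : Barb) : Prop :=
  ∃ P', Steps P P' ∧ barb P' μ

/-! ## Translated barbed bisimilarity (Definitions 25 and 26) and congruence -/

/-- `R` is a translated barbed bisimulation with respect to the translated
observables `barb` (Definition 25). -/
def IsTransBisim (barb : Proc → Barb → Prop) (R : Proc → Proc → Prop) : Prop :=
  ∀ P Q, R P Q →
    (reachSuccess P ↔ reachSuccess Q) ∧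
    (∀ μ, weakBarb barb P μ ↔ weakBarb barb Q μ) ∧
    (∀ P', Reduces P P' → ∃ Q', Steps Q Q' ∧ R P' Q') ∧
    (∀ Q', Reduces Q Q' → ∃ P', Steps P P' ∧ R P' Q')

/-- `R` is a weak translated barbed bisimulation (Definition 26), not
distinguishing terms by reachable intermediate states. -/
def IsTransBisim2 (barb : Proc → Barb → Prop) (R : Proc → Proc → Prop) : Prop :=
  ∀ P Q, R P Q →
    (reachSuccess P ↔ reachSuccess Q) ∧
    (∀ μ, weakBarb barb P μ ↔ weakBarb barb Q μ) ∧
    (∀ P', Steps P P' → ∃ P'' Q'', Steps Q Q'' ∧ Steps P' P'' ∧ R P'' Q'') ∧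
    (∀ Q', Steps Q Q' → ∃ Q'' P'', Steps P P'' ∧ Steps Q' Q'' ∧ R P'' Q'')

/-- Translated barbed bisimilarity `≐ˢₐ` with respect to `⟦·⟧ˢₐ`. -/
def transBisimSA (P Q : Proc) : Prop := ∃ R, IsTransBisim transBarbSA R ∧ R P Q

/-- Translated barbed bisimilarity `≐ᵐₐ,₁` with respect to `⟦·⟧ᵐₐ`. -/
def transBisimMA1 (P Q : Proc) : Prop := ∃ R, IsTransBisim transBarbMA R ∧ R P Q

/-- Weak translated barbed bisimilarity `≐ᵐₐ,₂` with respect to `⟦·⟧ᵐₐ`. -/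
def transBisimMA2 (P Q : Proc) : Prop := ∃ R, IsTransBisim2 transBarbMA R ∧ R P Q

/-- Translated barbed congruence `≅ˢₐ` (Definition 28): closure of `≐ˢₐ` under all
πₐ-contexts that map target terms to target terms. -/
def transCongSA (T₁ T₂ : Proc) : Prop :=
  ∀ C : Proc → Proc, TargetSA (C (encSA .nil)) → transBisimSA (C T₁) (C T₂)

/-- Translated barbed congruence `≅ᵐₐ,₁`. -/
def transCongMA1 (T₁ T₂ : Proc) : Prop :=
  ∀ C : Proc → Proc, TargetMA (C (encMA .nil)) → transBisimMA1 (C T₁) (C T₂)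

/-- Weak translated barbed congruence `≅ᵐₐ,₂`. -/
def transCongMA2 (T₁ T₂ : Proc) : Prop :=
  ∀ C : Proc → Proc, TargetMA (C (encMA .nil)) → transBisimMA2 (C T₁) (C T₂)

/-! ## Pieces of target terms and junk (Definitions 31 and 32) -/

/-- Pieces of target terms of `⟦·⟧ˢₐ` (Definition 31). -/
inductive PieceSA : Proc → Prop
  | target {T : Proc} : TargetSA T → PieceSA T
  | drop {T T' J : Proc} {xs : List Name} :
      StructCong T (resList xs T') →
      transCongSA T (resList xs (.par T' J)) →
      PieceSA (resList xs (.par T' J)) → PieceSA T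

/-- Pieces of target terms of `⟦·⟧ᵐₐ` (Definition 31). -/
inductive PieceMA : Proc → Prop
  | target {T : Proc} : TargetMA T → PieceMA T
  | drop {T T' J : Proc} {xs : List Name} :
      StructCong T (resList xs T') →
      transCongMA1 T (resList xs (.par T' J)) →
      PieceMA (resList xs (.par T' J)) → PieceMA T

/-- `J` is junk of `⟦·⟧ˢₐ` modulo `≐ˢₐ` (Definition 32). -/
def JunkSA (J : Proc) : Prop :=
  ∀ C : Proc → Proc, PieceSA (C J) → transBisimSA (C J) (C .nil)

/-- `J` is junk of `⟦·⟧ᵐₐ` modulo `≐ᵐₐ` (Definition 32). -/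
def JunkMA (J : Proc) : Prop :=
  ∀ C : Proc → Proc, PieceMA (C J) → transBisimMA1 (C J) (C .nil)

/-! ## Pure administrative steps (Definition 23) -/

/-- A pure administrative step of `⟦·⟧ˢₐ`: a step that is neither on a sum lock
nor on a translated source term name. -/
def PureAdminStepSA (T₁ T₂ : Proc) : Prop :=
  ∃ a : Option Name, LabStep T₁ a T₂ ∧
    ∀ l : Name, a = some l → ¬ IsSumLock T₁ l ∧ (¬ ∃ n : Name, phiSA n = l)

/-- A sequence of pure administrative steps of `⟦·⟧ˢₐ`. -/
def PureAdminStepsSA : Proc → Proc → Prop := Relation.ReflTransGen PureAdminStepSA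

/-! ## Gorla's quality criteria (Definitions 5–11) -/

/-- Criterion 1 (compositionality): every operator is translated by a fixed context,
parametrisable on the free names of its parameters, applied to the translations
of its parameters. -/
def Compositional (enc : Proc → Proc) (lang : Proc → Prop) : Prop :=
  (∃ C : Name → Finset Name → Proc → Proc,
    ∀ (x : Name) (S : Proc), lang (.res x S) → enc (.res x S) = C x (freeNames S) (enc S)) ∧
  (∃ C : Finset Name → Proc → Proc → Proc,
    ∀ S₁ S₂ : Proc, lang (.par S₁ S₂) →
      enc (.par S₁ S₂) = C (freeNames S₁ ∪ freeNames S₂) (enc S₁) (enc S₂)) ∧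
  (∃ C : Name → Name → Finset Name → Proc → Proc,
    ∀ (a b : Name) (S : Proc), lang (.mat a b S) →
      enc (.mat a b S) = C a b (freeNames S) (enc S)) ∧
  (∃ C : Name → List Name → Finset Name → Proc → Proc,
    ∀ (y : Name) (xs : List Name) (S : Proc), lang (.inp y xs S) →
      enc (.inp y xs S) = C y xs (freeNames S) (enc S)) ∧
  (∃ C : Name → List Name → Finset Name → Proc → Proc,
    ∀ (y : Name) (zs : List Name) (S : Proc), lang (.out y zs S) →
      enc (.out y zs S) = C y zs (freeNames S) (enc S)) ∧
  (∃ C : Name → List Name → Finset Name → Proc → Proc,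
    ∀ (y : Name) (xs : List Name) (S : Proc), lang (.rep y xs S) →
      enc (.rep y xs S) = C y xs (freeNames S) (enc S)) ∧
  (∃ C : Finset Name → Proc → Proc,
    ∀ S : Proc, lang (.tau S) → enc (.tau S) = C (freeNames S) (enc S)) ∧
  (∃ C : Finset Name → Proc → Proc → Proc,
    ∀ S₁ S₂ : Proc, lang (.choice S₁ S₂) →
      enc (.choice S₁ S₂) = C (freeNames S₁ ∪ freeNames S₂) (enc S₁) (enc S₂))

/-- Criterion 2 (name invariance) with respect to the renaming policy `φ` and the
equivalence `eqv` on the target. -/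
def NameInvariant (enc : Proc → Proc) (lang : Proc → Prop) (φ : Name → Name)
    (eqv : Proc → Proc → Prop) : Prop :=
  ∀ (S : Proc) (σ : Name → Name), lang S → ∃ σ' : Name → Name,
    (∀ n : Name, φ (σ n) = σ' (φ n)) ∧
    (Function.Injective σ → AlphaEq (enc (applySubst σ S)) (applySubst σ' (enc S))) ∧
    (¬ Function.Injective σ → eqv (enc (applySubst σ S)) (applySubst σ' (enc S)))

/-- operational completeness (half of Criterion 3) -/
def OperationallyComplete (enc : Proc → Proc) (lang : Proc → Prop)
    (eqv : Proc → Proc → Prop) : Prop :=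
  ∀ S S' : Proc, lang S → Steps S S' → ∃ T : Proc, Steps (enc S) T ∧ eqv T (enc S')

/-- operational soundness (half of Criterion 3) -/
def OperationallySound (enc : Proc → Proc) (lang : Proc → Prop)
    (eqv : Proc → Proc → Prop) : Prop :=
  ∀ S T : Proc, lang S → Steps (enc S) T →
    ∃ S' T' : Proc, Steps S S' ∧ Steps T T' ∧ eqv T' (enc S')

/-- Criterion 4 (divergence reflection) -/
def DivergenceReflecting (enc : Proc → Proc) (lang : Proc → Prop) : Prop :=
  ∀ S : Proc, lang S → Divergent (enc S) → Divergent S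

/-- Criterion 5 (success sensitiveness) -/
def SuccessSensitive (enc : Proc → Proc) (lang : Proc → Prop) : Prop :=
  ∀ S : Proc, lang S → (reachSuccess S ↔ reachSuccess (enc S))

/-- The equivalence `eqv` is success respecting (Definition 11). -/
def SuccessRespecting (eqv : Proc → Proc → Prop) : Prop :=
  ∀ P Q : Proc, reachSuccess P → ¬ reachSuccess Q → ¬ eqv P Q

/-- A good encoding in the sense of Gorla: it satisfies the five criteria
with respect to the behavioural equivalence `eqv` on the target language. -/
def GoodEncoding (enc : Proc → Proc) (lang : Proc → Prop) (φ : Name → Name)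
    (eqv : Proc → Proc → Prop) : Prop :=
  Compositional enc lang ∧
  NameInvariant enc lang φ eqv ∧
  OperationallyComplete enc lang eqv ∧
  OperationallySound enc lang eqv ∧
  DivergenceReflecting enc lang ∧
  SuccessSensitive enc lang

/-! ## Preservation of the degree of distribution (Definition 5 of [PN12]) -/

/-- `enc` preserves the degree of distribution: for every source term
`S ≡ᵣₑₚ S₁ ∣ … ∣ Sₙ` with `Sᵢ ⟹ Sᵢ'` there are target terms `T₁, …, Tₙ` and an
`n`-ary context `C` such that `enc S ≡ᵣₑₚ C[T₁, …, Tₙ]` and `Tᵢ ⟹ ≍ enc Sᵢ'`. -/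
def PreservesDistribution (enc : Proc → Proc) (lang : Proc → Prop)
    (eqv : Proc → Proc → Prop) : Prop :=
  ∀ (S : Proc) (SL SL' : List Proc), lang S →
    StructCongRep S (parList SL) →
    List.Forall₂ Steps SL SL' →
    ∃ (TL : List Proc) (C : List Proc → Proc),
      TL.length = SL.length ∧
      StructCongRep (enc S) (C TL) ∧
      List.Forall₂ (fun T S' => ∃ T', Steps T T' ∧ eqv T' (enc S')) TL SL'


/-! ## Alpha-equivalence in terms of the named syntax -/

theorem dbVar_cons_eq_iff (x y a b : Name) (e₁ e₂ : List Name) :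
    dbVar (x :: e₁) a = dbVar (y :: e₂) b ↔
      (a = x ∧ b = y) ∨ (a ≠ x ∧ b ≠ y ∧ dbVar e₁ a = dbVar e₂ b) := by
  have key : ∀ (x a : Name) (e : List Name), dbVar (x :: e) a =
      if a = x then .bound 0 else
        match dbVar e a with
        | .bound i => .bound (i + 1)
        | .free n => .free n := by
    intro x a e
    unfold dbVar
    rw [List.findIdx?_cons]
    by_cases h : a = x
    · simp [h]
    · have h' : ¬ x = a := fun h' => h h'.symm
      simp only [h, h', beq_iff_eq, if_false]
      cases List.findIdx? (fun z => z == a) e <;> simp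
  rw [key, key]
  by_cases h₁ : a = x <;> by_cases h₂ : b = y <;> simp only [h₁, h₂, if_true, if_false] <;>
    cases h₃ : dbVar e₁ a <;> cases h₄ : dbVar e₂ b <;> simp_all

theorem dbVar_nil (a : Name) : dbVar [] a = .free a := rfl

theorem dbVar_injective (e : List Name) : Function.Injective (dbVar e) := by
  induction e with
  | nil => intro a b h; simpa [dbVar_nil] using h
  | cons x e ih =>
    intro a b h
    rcases (dbVar_cons_eq_iff ..).1 h with ⟨rfl, rfl⟩ | ⟨_, _, h⟩
    · rfl
    · exact ih h

theorem dbVar_append_eq {xs ys : List Name} (hl : xs.length = ys.length) {a b : Name}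
    {e₁ e₂ : List Name} (h : dbVar (xs ++ e₁) a = dbVar (ys ++ e₂) b) :
    (a ∈ xs ∧ b ∈ ys) ∨ (a ∉ xs ∧ b ∉ ys ∧ dbVar e₁ a = dbVar e₂ b) := by
  induction xs generalizing ys with
  | nil =>
    obtain rfl : ys = [] := by simpa using hl.symm
    exact .inr (by simpa using h)
  | cons x xs ih =>
    obtain _ | ⟨y, ys⟩ := ys
    · simp at hl
    · rcases (dbVar_cons_eq_iff ..).1 h with ⟨rfl, rfl⟩ | ⟨h₁, h₂, h⟩
      · simp
      · rcases ih (by simpa using hl) h with h | h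
        · exact .inl (by simp [h])
        · exact .inr (by simp [h, h₁, h₂])

theorem exists_mem_freeNames_of_toDB_eq {P Q : Proc} {e₁ e₂ : List Name}
    (h : toDB e₁ P = toDB e₂ Q) {n : Name} (hn : n ∈ freeNames P) :
    ∃ m ∈ freeNames Q, dbVar e₁ n = dbVar e₂ m := by
  have binder : ∀ {xs ys : List Name} {P Q : Proc} {e₁ e₂ : List Name},
      xs.length = ys.length →
      (∃ m ∈ freeNames Q, dbVar (xs.reverse ++ e₁) n = dbVar (ys.reverse ++ e₂) m) →
      n ∉ xs → ∃ m ∈ freeNames Q, m ∉ ys ∧ dbVar e₁ n = dbVar e₂ m := by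
    rintro xs ys P Q e₁ e₂ hl ⟨m, hm, h⟩ hn
    rcases dbVar_append_eq (by simpa using hl) h with h | h
    · exact absurd (by simpa using h.1) hn
    · exact ⟨m, hm, by simpa using h.2.1, h.2.2⟩
  induction P generalizing Q e₁ e₂ with
  | nil => simp [freeNames] at hn
  | succ => simp [freeNames] at hn
  | res x P ih =>
    cases Q <;> simp [toDB] at h
    simp [freeNames] at hn ⊢
    obtain ⟨m, hm, h'⟩ := ih h hn.1
    rcases (dbVar_cons_eq_iff ..).1 h' with h' | h'
    · exact absurd h'.1 hn.2
    · exact ⟨m, ⟨hm, h'.2.1⟩, h'.2.2⟩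
  | par P Q ihP ihQ =>
    cases Q <;> simp [toDB] at h
    simp [freeNames] at hn ⊢
    rcases hn with hn | hn
    · obtain ⟨m, hm, h'⟩ := ihP h.1 hn
      exact ⟨m, .inl hm, h'⟩
    · obtain ⟨m, hm, h'⟩ := ihQ h.2 hn
      exact ⟨m, .inr hm, h'⟩
  | choice P Q ihP ihQ =>
    cases Q <;> simp [toDB] at h
    simp [freeNames] at hn ⊢
    rcases hn with hn | hn
    · obtain ⟨m, hm, h'⟩ := ihP h.1 hn
      exact ⟨m, .inl hm, h'⟩
    · obtain ⟨m, hm, h'⟩ := ihQ h.2 hn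
      exact ⟨m, .inr hm, h'⟩
  | mat a b P ih =>
    cases Q <;> simp [toDB] at h
    simp [freeNames] at hn ⊢
    rcases hn with rfl | rfl | hn
    · exact .inl h.1
    · exact .inr (.inl h.2.1)
    · exact .inr (.inr (ih h.2.2 hn))
  | tau P ih =>
    cases Q <;> simp [toDB] at h
    simpa [freeNames] using ih h hn
  | out y zs P ih =>
    cases Q <;> simp [toDB] at h
    simp [freeNames] at hn ⊢
    rcases hn with rfl | hn | hn
    · exact .inl h.1
    · have := List.mem_map_of_mem (f := dbVar e₁) hn
      rw [h.2.1] at this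
      obtain ⟨m, hm, h'⟩ := List.mem_map.1 this
      exact .inr ⟨m, .inl hm, h'.symm⟩
    · obtain ⟨m, hm, h'⟩ := ih h.2.2 hn
      exact .inr ⟨m, .inr hm, h'⟩
  | inp y xs P ih =>
    cases Q <;> simp [toDB] at h
    simp [freeNames] at hn ⊢
    rcases hn with rfl | hn
    · exact .inl h.1
    · obtain ⟨m, hm, h₁, h₂⟩ := binder (P := P) h.2.1 (ih h.2.2 hn.1) hn.2
      exact .inr ⟨m, ⟨hm, h₁⟩, h₂⟩
  | rep y xs P ih =>
    cases Q <;> simp [toDB] at h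
    simp [freeNames] at hn ⊢
    rcases hn with rfl | hn
    · exact .inl h.1
    · obtain ⟨m, hm, h₁, h₂⟩ := binder (P := P) h.2.1 (ih h.2.2 hn.1) hn.2
      exact .inr ⟨m, ⟨hm, h₁⟩, h₂⟩

theorem AlphaEq.freeNames_subset {P Q : Proc} (h : AlphaEq P Q) :
    freeNames P ⊆ freeNames Q := by
  intro n hn
  obtain ⟨m, hm, h'⟩ := exists_mem_freeNames_of_toDB_eq h hn
  simp only [dbVar_nil, DBName.free.injEq] at h'
  exact h' ▸ hm

/-! ## Renaming of all names, binders included -/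

def renameAll (f : Name → Name) : Proc → Proc
  | .nil => .nil
  | .succ => .succ
  | .res x P => .res (f x) (renameAll f P)
  | .par P Q => .par (renameAll f P) (renameAll f Q)
  | .mat a b P => .mat (f a) (f b) (renameAll f P)
  | .inp y xs P => .inp (f y) (xs.map f) (renameAll f P)
  | .out y zs P => .out (f y) (zs.map f) (renameAll f P)
  | .rep y xs P => .rep (f y) (xs.map f) (renameAll f P)
  | .tau P => .tau (renameAll f P)
  | .choice P Q => .choice (renameAll f P) (renameAll f Q)

theorem renameAll_id (P : Proc) : renameAll id P = P := by
  induction P <;> simp_all [renameAll]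

theorem renameAll_comp (f g : Name → Name) (P : Proc) :
    renameAll f (renameAll g P) = renameAll (f ∘ g) P := by
  induction P <;> simp_all [renameAll]

theorem freeNames_renameAll {f : Name → Name} (hf : Function.Injective f) (P : Proc) :
    freeNames (renameAll f P) = (freeNames P).image f := by
  induction P with
  | inp y xs P ih | rep y xs P ih =>
    ext n
    simp only [renameAll, freeNames, ih, Finset.mem_insert, Finset.mem_sdiff, Finset.mem_image,
      List.mem_toFinset, List.mem_map]
    have : ∀ a b, f a = f b → a = b := fun _ _ h => hf h
    grind
  | res x P ih =>
    ext n
    simp only [renameAll, freeNames, ih, Finset.mem_singleton, Finset.mem_sdiff, Finset.mem_image]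
    have : ∀ a b, f a = f b → a = b := fun _ _ h => hf h
    grind
  | out y zs P ih =>
    ext n
    simp only [renameAll, freeNames, ih, Finset.mem_insert, Finset.mem_union, Finset.mem_image,
      List.mem_toFinset, List.mem_map]
    grind
  | _ => simp_all [renameAll, freeNames, Finset.image_union]

theorem toDB_renameAll {f : Name → Name} (hf : Function.Injective f) {P : Proc}
    {e₁ e₂ : List Name} (h : ∀ n ∈ freeNames P, dbVar e₁ n = dbVar e₂ (f n)) :
    toDB e₁ P = toDB e₂ (renameAll f P) := by
  have binder : ∀ (xs : List Name) (n : Name) (e₁ e₂ : List Name),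
      (n ∉ xs → dbVar e₁ n = dbVar e₂ (f n)) →
      dbVar (xs ++ e₁) n = dbVar (xs.map f ++ e₂) (f n) := by
    intro xs n e₁ e₂ h
    induction xs with
    | nil => simpa using h
    | cons x xs ih =>
      simp only [List.cons_append, List.map_cons, dbVar_cons_eq_iff, hf.eq_iff]
      by_cases hx : n = x
      · exact .inl ⟨hx, hx⟩
      · exact .inr ⟨hx, hf.ne hx, ih fun hn => h (by simp [hx, hn])⟩
  induction P generalizing e₁ e₂ with
  | nil => rfl
  | succ => rfl
  | res x P ih =>
    simp only [renameAll, toDB]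
    congr 1
    refine ih fun n hn => binder [x] n e₁ e₂ fun hx => h n ?_
    simpa [freeNames, hn] using hx
  | inp y xs P ih =>
    simp only [renameAll, toDB, List.length_map]
    congr 1
    · exact h y (by simp [freeNames])
    · rw [← List.map_reverse]
      refine ih fun n hn => binder xs.reverse n e₁ e₂ fun hx => h n ?_
      simp only [List.mem_reverse] at hx
      simp [freeNames, hn, hx]
  | rep y xs P ih =>
    simp only [renameAll, toDB, List.length_map]
    congr 1
    · exact h y (by simp [freeNames])
    · rw [← List.map_reverse]
      refine ih fun n hn => binder xs.reverse n e₁ e₂ fun hx => h n ?_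
      simp only [List.mem_reverse] at hx
      simp [freeNames, hn, hx]
  | out y zs P ih =>
    simp only [renameAll, toDB, List.map_map]
    congr 1
    · exact h y (by simp [freeNames])
    · exact List.map_congr_left fun n hn => h n (by simp [freeNames, hn])
    · exact ih fun n hn => h n (by simp [freeNames, hn])
  | par P Q ihP ihQ | choice P Q ihP ihQ =>
    simp only [renameAll, toDB]
    congr 1
    · exact ihP fun n hn => h n (by simp [freeNames, hn])
    · exact ihQ fun n hn => h n (by simp [freeNames, hn])
  | mat a b P ih =>
    simp only [renameAll, toDB]
    congr 1
    · exact h a (by simp [freeNames])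
    · exact h b (by simp [freeNames])
    · exact ih fun n hn => h n (by simp [freeNames, hn])
  | tau P ih =>
    simp only [renameAll, toDB]
    congr 1
    exact ih fun n hn => h n (by simpa [freeNames] using hn)

theorem alphaEq_res_swap {x x' : Name} {P : Proc} (h : x' ∉ freeNames (.res x P)) :
    AlphaEq (.res x P) (.res x' (renameAll (Equiv.swap x x') P)) := by
  simp only [AlphaEq, toDB]
  congr 1
  refine toDB_renameAll (Equiv.injective _) fun n hn => ?_
  rw [dbVar_cons_eq_iff]
  by_cases hx : n = x
  · exact .inl ⟨hx, by simp [hx]⟩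
  · have hx' : n ≠ x' := by
      rintro rfl
      exact h (by simp [freeNames, hn, hx])
    rw [Equiv.swap_apply_of_ne_of_ne hx hx']
    exact .inr ⟨hx, hx', rfl⟩

/-! ## Removing the unguarded trivial matches -/

def stripMat : Proc → Proc
  | .res x P => .res x (stripMat P)
  | .par P Q => .par (stripMat P) (stripMat Q)
  | .mat a b P => if a = b then stripMat P else .mat a b P
  | P => P

theorem structCong_stripMat (P : Proc) : StructCong P (stripMat P) := by
  induction P with
  | res x P ih => exact .resCong ih
  | par P Q ihP ihQ => exact .parCong ihP ihQ
  | mat a b P ih =>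
    by_cases h : a = b
    · subst h
      simpa [stripMat] using StructCongX.matElim.trans ih
    · simpa [stripMat, h] using StructCongX.refl
  | _ => exact .refl

theorem freeNames_stripMat_subset (P : Proc) : freeNames (stripMat P) ⊆ freeNames P := by
  induction P with
  | res x P ih => exact Finset.sdiff_subset_sdiff ih subset_rfl
  | par P Q ihP ihQ => exact Finset.union_subset_union ihP ihQ
  | mat a b P ih =>
    by_cases h : a = b
    · simp only [stripMat, h, if_true, freeNames]
      exact ih.trans ((Finset.subset_insert _ _).trans (Finset.subset_insert _ _))
    · simp [stripMat, h]
  | _ => exact subset_rfl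

theorem toDB_stripMat_eq {P Q : Proc} {e₁ e₂ : List Name} (h : toDB e₁ P = toDB e₂ Q) :
    toDB e₁ (stripMat P) = toDB e₂ (stripMat Q) := by
  induction P generalizing Q e₁ e₂ with
  | res x P ih =>
    cases Q <;> simp [toDB] at h
    simpa [stripMat, toDB] using ih h
  | par P Q ihP ihQ =>
    cases Q <;> simp [toDB] at h
    simpa [stripMat, toDB] using ⟨ihP h.1, ihQ h.2⟩
  | mat a b P ih =>
    cases Q with
    | mat a' b' Q =>
      have h' := h
      simp only [toDB, DB.mat.injEq] at h
      have hab : a = b ↔ a' = b' := by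
        rw [← (dbVar_injective e₁).eq_iff, ← (dbVar_injective e₂).eq_iff, h.1, h.2.1]
      by_cases hc : a = b
      · simpa [stripMat, hc, hab.1 hc] using ih h.2.2
      · simpa [stripMat, hc, hab.not.1 hc] using h'
    | _ => simp [toDB] at h
  | _ => cases Q <;> simp [toDB] at h <;> simp [stripMat, toDB, h]

theorem StructCong.freeNames_stripMat {b : Bool} {P Q : Proc} (h : StructCongX b P Q) :
    freeNames (stripMat P) = freeNames (stripMat Q) := by
  induction h with
  | alpha h =>
    have h' := toDB_stripMat_eq h
    exact subset_antisymm (AlphaEq.freeNames_subset h') (AlphaEq.freeNames_subset h'.symm)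
  | parNil => simp [stripMat, freeNames]
  | parComm => simp [stripMat, freeNames, Finset.union_comm]
  | parAssoc => simp [stripMat, freeNames, Finset.union_assoc]
  | matElim => simp [stripMat]
  | resNil => simp [stripMat, freeNames]
  | resSwap => ext; simp [stripMat, freeNames]; tauto
  | @resPar _ n P Q hn =>
    have hn' : n ∉ freeNames (stripMat P) := fun h => hn (freeNames_stripMat_subset P h)
    ext m
    simp [stripMat, freeNames]
    grind
  | repSplit => simp [stripMat, freeNames]
  | refl => rfl
  | symm _ ih => exact ih.symm
  | trans _ _ ih₁ ih₂ => exact ih₁.trans ih₂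
  | resCong _ ih => simp [stripMat, freeNames, ih]
  | parCong _ _ ih₁ ih₂ => simp [stripMat, freeNames, ih₁, ih₂]

/-! ## Unguarded outputs -/

/-- `P` has an unguarded output carrying the values `zs`, where its free names are read
through `σ` and the names restricted above the output are renamed to names outside `A`. -/
def Offers (zs : List Name) : (Name → Name) → Finset Name → Proc → Prop
  | σ, _, .out _ ws _ => ws.map σ = zs
  | σ, A, .par P Q => Offers zs σ A P ∨ Offers zs σ A Q
  | σ, A, .res x P => ∃ x' ∉ A, Offers zs (Function.update σ x x') (insert x' A) P
  | σ, A, .mat a b P => a = b ∧ Offers zs σ A P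
  | _, _, _ => False

theorem Offers.mono {zs : List Name} {P : Proc} {σ σ' : Name → Name} {A A' : Finset Name}
    (hσ : ∀ n ∈ freeNames P, σ n ∈ zs → σ' n = σ n) (hA : ∀ a ∈ A', a ∈ zs → a ∈ A)
    (h : Offers zs σ A P) : Offers zs σ' A' P := by
  induction P generalizing σ σ' A A' with
  | out y ws P ih =>
    simp only [Offers] at h ⊢
    rw [← h]
    refine List.map_congr_left fun w hw => hσ w (by simp [freeNames, hw]) ?_
    rw [← h]
    exact List.mem_map_of_mem hw
  | par P Q ihP ihQ =>
    exact h.imp (ihP (fun n hn => hσ n (by simp [freeNames, hn])) hA)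
      (ihQ (fun n hn => hσ n (by simp [freeNames, hn])) hA)
  | mat a b P ih =>
    exact ⟨h.1, ih (fun n hn => hσ n (by simp [freeNames, hn])) hA h.2⟩
  | res x P ih =>
    obtain ⟨x', hx', h⟩ := h
    by_cases hz : x' ∈ zs
    · refine ⟨x', fun hc => hx' (hA _ hc hz), ih (fun n hn hn' => ?_) (fun a ha haz => ?_) h⟩
      · by_cases hnx : n = x
        · simp [hnx]
        · rw [Function.update_of_ne hnx] at hn' ⊢
          rw [Function.update_of_ne hnx]
          exact hσ n (by simp [freeNames, hn, hnx]) hn'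
      · have := hA a
        grind
    · obtain ⟨x'', hx''⟩ := Infinite.exists_notMem_finset (A' ∪ zs.toFinset)
      simp only [Finset.mem_union, List.mem_toFinset, not_or] at hx''
      refine ⟨x'', hx''.1, ih (fun n hn hn' => ?_) (fun a ha haz => ?_) h⟩
      · by_cases hnx : n = x
        · subst hnx
          simp [hz] at hn'
        · rw [Function.update_of_ne hnx] at hn' ⊢
          rw [Function.update_of_ne hnx]
          exact hσ n (by simp [freeNames, hn, hnx]) hn'
      · have := hA a
        grind
  | _ => exact h

theorem Offers.of_toDB_eq {zs : List Name} {P Q : Proc} {e₁ e₂ : List Name}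
    {σ₁ σ₂ : Name → Name} {A : Finset Name} (h : toDB e₁ P = toDB e₂ Q)
    (hσ : ∀ a b, dbVar e₁ a = dbVar e₂ b → σ₁ a = σ₂ b) (ho : Offers zs σ₁ A P) :
    Offers zs σ₂ A Q := by
  induction P generalizing Q e₁ e₂ σ₁ σ₂ A with
  | out y ws P ih =>
    cases Q <;> simp [toDB] at h
    rename_i y' ws' Q
    obtain ⟨-, h, -⟩ := h
    simp only [Offers] at ho ⊢
    rw [← ho]
    clear ho
    induction ws generalizing ws' with
    | nil => simp_all
    | cons w ws ihw =>
      obtain _ | ⟨w', ws'⟩ := ws'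
      · simp at h
      · simp only [List.map_cons, List.cons.injEq] at h ⊢
        exact ⟨(hσ _ _ h.1).symm, ihw _ h.2⟩
  | par P Q ihP ihQ =>
    cases Q <;> simp [toDB] at h
    exact ho.imp (ihP h.1 hσ) (ihQ h.2 hσ)
  | mat a b P ih =>
    cases Q <;> simp [toDB] at h
    obtain ⟨rfl, ho⟩ := ho
    exact ⟨dbVar_injective e₂ (h.1.symm.trans h.2.1), ih h.2.2 hσ ho⟩
  | res x P ih =>
    cases Q <;> simp [toDB] at h
    obtain ⟨x', hx', ho⟩ := ho
    refine ⟨x', hx', ih h (fun a b hab => ?_) ho⟩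
    rcases (dbVar_cons_eq_iff ..).1 hab with ⟨rfl, rfl⟩ | ⟨h₁, h₂, h⟩
    · simp
    · rw [Function.update_of_ne h₁, Function.update_of_ne h₂]
      exact hσ _ _ h
  | _ => exact ho.elim

theorem offers_of_alphaEq {zs : List Name} {P Q : Proc} {σ : Name → Name} {A : Finset Name}
    (h : AlphaEq P Q) (ho : Offers zs σ A P) : Offers zs σ A Q :=
  ho.of_toDB_eq h fun a b hab => by
    simp only [dbVar_nil, DBName.free.injEq] at hab
    rw [hab]

theorem StructCong.offers_iff {b : Bool} {zs : List Name} {P Q : Proc} (h : StructCongX b P Q)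
    {σ : Name → Name} {A : Finset Name} : Offers zs σ A P ↔ Offers zs σ A Q := by
  induction h generalizing σ A with
  | alpha h => exact ⟨offers_of_alphaEq h, offers_of_alphaEq h.symm⟩
  | parNil => simp [Offers]
  | parComm => simp [Offers, or_comm]
  | parAssoc => simp [Offers, or_assoc]
  | matElim => simp [Offers]
  | resNil => simp [Offers]
  | @resSwap _ n m P =>
    by_cases hnm : n = m
    · rw [hnm]
    · simp only [Offers, Finset.mem_insert, not_or]
      constructor
      · rintro ⟨x, hx, y, ⟨hyx, hy⟩, h⟩
        refine ⟨y, hy, x, ⟨Ne.symm hyx, hx⟩, ?_⟩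
        rwa [Function.update_comm (Ne.symm hnm), Finset.insert_comm]
      · rintro ⟨x, hx, y, ⟨hyx, hy⟩, h⟩
        refine ⟨y, hy, x, ⟨Ne.symm hyx, hx⟩, ?_⟩
        rwa [Function.update_comm hnm, Finset.insert_comm]
  | @resPar _ n P Q hn =>
    have upd : ∀ x, ∀ m ∈ freeNames P, Function.update σ n x m = σ m := fun x m hm =>
      Function.update_of_ne (by rintro rfl; exact hn hm) _ _
    simp only [Offers]
    constructor
    · rintro (h | ⟨x, hx, h⟩)
      · obtain ⟨x, hx⟩ := Infinite.exists_notMem_finset (A ∪ zs.toFinset)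
        simp only [Finset.mem_union, List.mem_toFinset, not_or] at hx
        refine ⟨x, hx.1, .inl (h.mono (fun m hm _ => upd x m hm) ?_)⟩
        grind
      · exact ⟨x, hx, .inr h⟩
    · rintro ⟨x, hx, h | h⟩
      · exact .inl (h.mono (fun m hm _ => (upd x m hm).symm) (by grind))
      · exact .inr ⟨x, hx, h⟩
  | repSplit => simp [Offers]
  | refl => rfl
  | symm _ ih => exact ih.symm
  | trans _ _ ih₁ ih₂ => exact ih₁.trans ih₂
  | resCong _ ih => simp only [Offers, ih]
  | parCong _ _ ih₁ ih₂ => simp only [Offers, ih₁, ih₂]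

theorem offers_resList {zs xs : List Name} {P : Proc} {p : Name} {σ : Name → Name}
    {A : Finset Name} (hσ : ∀ z ∈ zs, z ∉ xs → σ z = z) (hA : ∀ z ∈ zs, z ∈ xs → z ∉ A) :
    Offers zs σ A (resList xs (.par P (.out p zs .nil))) := by
  induction xs generalizing σ A with
  | nil =>
    refine .inr ?_
    simp only [Offers]
    conv_rhs => rw [← List.map_id zs]
    exact List.map_congr_left fun z hz => hσ z hz (by simp)
  | cons x xs ih =>
    by_cases hx : x ∈ zs ∧ x ∉ xs
    · refine ⟨x, hA x hx.1 (by simp), ih (fun z hz hzx => ?_) (fun z hz hzx => ?_)⟩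
      · by_cases hzx' : z = x
        · simp [hzx']
        · rw [Function.update_of_ne hzx']
          exact hσ z hz (by simp [hzx, hzx'])
      · have := hA z hz
        grind
    · obtain ⟨x', hx'⟩ := Infinite.exists_notMem_finset (A ∪ zs.toFinset)
      simp only [Finset.mem_union, List.mem_toFinset, not_or] at hx'
      refine ⟨x', hx'.1, ih (fun z hz hzx => ?_) (fun z hz hzx => ?_)⟩
      · have hzx' : z ≠ x := by rintro rfl; exact hx ⟨hz, hzx⟩
        rw [Function.update_of_ne hzx']
        exact hσ z hz (by simp [hzx, hzx'])
      · have := hA z hz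
        grind

/-! ## Processes relaying all requests -/

/-- `P` emits `zs` in parallel with other components. -/
def Emits (zs : List Name) : Proc → Prop
  | .out _ ws _ => ws = zs
  | .par P Q => Emits zs P ∨ Emits zs Q
  | _ => False

/-- Every input of a request (three or four parameters) in `P` re-emits the request
at once; moreover `P` is asynchronous and free of choice. -/
def Relays : Proc → Prop
  | .nil => True
  | .succ => True
  | .res _ P => Relays P
  | .par P Q => Relays P ∧ Relays Q
  | .mat _ _ P => Relays P
  | .inp _ xs P => (xs.length = 3 ∨ xs.length = 4 → xs.Nodup ∧ Emits xs P) ∧ Relays P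
  | .out _ _ P => P = .nil
  | .rep _ xs P => (xs.length = 3 ∨ xs.length = 4 → xs.Nodup ∧ Emits xs P) ∧ Relays P
  | .tau P => Relays P
  | .choice _ _ => False

theorem Emits.of_toDB_eq {P Q : Proc} {e₁ e₂ : List Name} {zs : List Name}
    (h : toDB e₁ P = toDB e₂ Q) (he : Emits zs P) :
    ∃ ws, Emits ws Q ∧ zs.map (dbVar e₁) = ws.map (dbVar e₂) := by
  induction P generalizing Q with
  | out y ws P ih =>
    cases Q <;> simp [toDB] at h
    obtain rfl : ws = zs := he
    exact ⟨_, rfl, h.2.1⟩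
  | par P Q ihP ihQ =>
    cases Q <;> simp [toDB] at h
    rcases he with he | he
    · obtain ⟨ws, hw, h'⟩ := ihP h.1 he
      exact ⟨ws, .inl hw, h'⟩
    · obtain ⟨ws, hw, h'⟩ := ihQ h.2 he
      exact ⟨ws, .inr hw, h'⟩
  | _ => exact he.elim

theorem nodup_and_eq_of_map_dbVar_eq {xs ys ws e₁ e₂ : List Name}
    (hl : xs.length = ys.length) (hn : xs.length = 3 ∨ xs.length = 4) (hx : xs.Nodup)
    (h : xs.map (dbVar (xs.reverse ++ e₁)) = ws.map (dbVar (ys.reverse ++ e₂))) :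
    ys.Nodup ∧ ws = ys := by
  have hw : xs.length = ws.length := by simpa using congrArg List.length h
  rcases hn with hn | hn
  · obtain ⟨a, b, c, rfl⟩ := List.length_eq_three.1 hn
    obtain ⟨a', b', c', rfl⟩ := List.length_eq_three.1 (hl.symm.trans hn)
    obtain ⟨a'', b'', c'', rfl⟩ := List.length_eq_three.1 (hw.symm.trans hn)
    simp [dbVar_cons_eq_iff] at h hx ⊢
    grind
  · obtain ⟨a, b, c, d, rfl⟩ := List.length_eq_four.1 hn
    obtain ⟨a', b', c', d', rfl⟩ := List.length_eq_four.1 (hl.symm.trans hn)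
    obtain ⟨a'', b'', c'', d'', rfl⟩ := List.length_eq_four.1 (hw.symm.trans hn)
    simp [dbVar_cons_eq_iff] at h hx ⊢
    grind

theorem Relays.of_toDB_eq {P Q : Proc} {e₁ e₂ : List Name}
    (h : toDB e₁ P = toDB e₂ Q) (hr : Relays P) : Relays Q := by
  induction P generalizing Q e₁ e₂ with
  | choice => exact hr.elim
  | nil | succ => cases Q <;> simp_all [toDB, Relays]
  | res x P ih =>
    cases Q <;> simp [toDB] at h
    exact (ih h hr :)
  | tau P ih =>
    cases Q <;> simp [toDB] at h
    exact (ih h hr :)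
  | mat a b P ih =>
    cases Q <;> simp [toDB] at h
    exact (ih h.2.2 hr :)
  | par P Q ihP ihQ =>
    cases Q <;> simp [toDB] at h
    exact ⟨ihP h.1 hr.1, ihQ h.2 hr.2⟩
  | out y zs P ih =>
    cases Q <;> simp [toDB] at h
    obtain rfl : P = .nil := hr
    rename_i Q
    cases Q <;> simp_all [toDB, Relays]
  | inp y xs P ih | rep y xs P ih =>
    cases Q <;> simp [toDB] at h
    obtain ⟨-, hl, h⟩ := h
    refine ⟨fun hn => ?_, ih h hr.2⟩
    rw [← hl] at hn
    obtain ⟨hx, he⟩ := hr.1 hn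
    obtain ⟨ws, hw, he⟩ := he.of_toDB_eq h
    obtain ⟨hy, rfl⟩ := nodup_and_eq_of_map_dbVar_eq hl hn hx he
    exact ⟨hy, hw⟩

theorem StructCong.relays_iff {b : Bool} {P Q : Proc} (h : StructCongX b P Q) :
    Relays P ↔ Relays Q := by
  induction h with
  | alpha h => exact ⟨Relays.of_toDB_eq h, Relays.of_toDB_eq h.symm⟩
  | refl => rfl
  | symm _ ih => exact ih.symm
  | trans _ _ ih₁ ih₂ => exact ih₁.trans ih₂
  | _ => simp_all [Relays, and_comm, and_assoc]

/-! ## Substitution -/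

theorem length_freshNames (A : Finset Name) (n : ℕ) : (freshNames A n).length = n := by
  induction n generalizing A with
  | zero => rfl
  | succ n ih => simp [freshNames, ih]

theorem freshName_notMem (A : Finset Name) : freshName A ∉ A := fun h => by
  have : freshName A ≤ A.sup id := Finset.le_sup (f := id) h
  exact Nat.not_succ_le_self _ this

theorem notMem_of_mem_freshNames {A : Finset Name} {n : ℕ} {x : Name}
    (h : x ∈ freshNames A n) : x ∉ A := by
  induction n generalizing A with
  | zero => simp [freshNames] at h
  | succ n ih =>
    rcases List.mem_cons.1 h with rfl | h
    · exact freshName_notMem A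
    · exact fun hx => ih h (Finset.mem_insert_of_mem hx)

theorem nodup_freshNames (A : Finset Name) (n : ℕ) : (freshNames A n).Nodup := by
  induction n generalizing A with
  | zero => simp [freshNames]
  | succ n ih =>
    exact List.nodup_cons.2
      ⟨fun h => notMem_of_mem_freshNames h (Finset.mem_insert_self _ _), ih _⟩

theorem updates_mem {xs zs : List Name} (hl : xs.length = zs.length) (σ : Name → Name)
    (n : Name) : (n ∈ xs ∧ updates σ xs zs n ∈ zs) ∨ (n ∉ xs ∧ updates σ xs zs n = σ n) := by
  induction xs generalizing zs with
  | nil => simp [updates]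
  | cons x xs ih =>
    obtain _ | ⟨z, zs⟩ := zs
    · simp at hl
    · by_cases hn : n = x
      · simp [updates, hn]
      · rcases ih (zs := zs) (by simpa using hl) with h | h <;>
          simp [updates, hn, h]

theorem map_updates {xs zs : List Name} (hl : xs.length = zs.length) (hx : xs.Nodup)
    (σ : Name → Name) : xs.map (updates σ xs zs) = zs := by
  induction xs generalizing zs with
  | nil => simpa using hl.symm
  | cons x xs ih =>
    obtain _ | ⟨z, zs⟩ := zs
    · simp at hl
    · rw [List.nodup_cons] at hx
      simp only [updates, List.map_cons, Function.update_self, List.cons.injEq, true_and]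
      conv_rhs => rw [← ih (zs := zs) (by simpa using hl) hx.2]
      exact List.map_congr_left fun y hy =>
        Function.update_of_ne (by rintro rfl; exact hx.1 hy) _ _

theorem freeNames_applySubstAux_subset (σ : Name → Name) (A : Finset Name) (P : Proc) :
    freeNames (applySubstAux σ A P) ⊆ (freeNames P).image σ := by
  induction P generalizing σ A with
  | res x P ih =>
    intro n hn
    simp only [applySubstAux, freeNames, Finset.mem_sdiff, Finset.mem_singleton] at hn
    obtain ⟨m, hm, hmn⟩ := Finset.mem_image.1 (ih _ _ hn.1)
    have hmx : m ≠ x := by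
      rintro rfl
      exact hn.2 (by simpa using hmn.symm)
    rw [Function.update_of_ne hmx] at hmn
    exact Finset.mem_image.2 ⟨m, by simp [freeNames, hm, hmx], hmn⟩
  | inp y xs P ih | rep y xs P ih =>
    intro n hn
    simp only [applySubstAux, freeNames, Finset.mem_insert, Finset.mem_sdiff,
      List.mem_toFinset] at hn
    rcases hn with rfl | ⟨hn, hn'⟩
    · exact Finset.mem_image_of_mem σ (by simp [freeNames])
    · obtain ⟨m, hm, rfl⟩ := Finset.mem_image.1 (ih _ _ hn)
      rcases updates_mem (length_freshNames A xs.length).symm σ m with h | h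
      · exact absurd h.2 hn'
      · exact Finset.mem_image.2 ⟨m, by simp [freeNames, hm, h.1], h.2.symm⟩
  | nil | succ => simp [applySubstAux, freeNames]
  | tau P ih => exact ih σ A
  | par P Q ihP ihQ | choice P Q ihP ihQ =>
    simp only [applySubstAux, freeNames, Finset.image_union]
    exact Finset.union_subset_union (ihP σ A) (ihQ σ A)
  | mat a b P ih =>
    simp only [applySubstAux, freeNames, Finset.image_insert]
    exact Finset.insert_subset_insert _ (Finset.insert_subset_insert _ (ih σ A))
  | out y zs P ih =>
    simp only [applySubstAux, freeNames, Finset.image_insert, Finset.image_union]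
    refine Finset.insert_subset_insert _ (Finset.union_subset_union ?_ (ih σ A))
    intro n hn
    simpa using hn

theorem freeNames_applySubst_subset {xs zs : List Name} (hl : xs.length = zs.length)
    (P : Proc) : freeNames (applySubst (updates id xs zs) P) ⊆
      (freeNames P \ xs.toFinset) ∪ zs.toFinset := by
  intro n hn
  obtain ⟨m, hm, rfl⟩ := Finset.mem_image.1 (freeNames_applySubstAux_subset _ _ _ hn)
  rcases updates_mem hl id m with h | h
  · simp [h.2]
  · simp [h.2, h.1, hm]

theorem Emits.applySubstAux {ws : List Name} {P : Proc} (h : Emits ws P) (σ : Name → Name)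
    (A : Finset Name) : Emits (ws.map σ) (applySubstAux σ A P) := by
  induction P with
  | out y zs P ih =>
    obtain rfl : zs = ws := h
    simp [PiCalc.applySubstAux, Emits]
  | par P Q ihP ihQ => exact h.imp ihP ihQ
  | _ => exact h.elim

theorem Relays.applySubstAux {P : Proc} (h : Relays P) (σ : Name → Name) (A : Finset Name) :
    Relays (applySubstAux σ A P) := by
  induction P generalizing σ A with
  | nil | succ => trivial
  | choice => exact h.elim
  | res x P ih | tau P ih | mat a b P ih => exact ih h _ _
  | par P Q ihP ihQ => exact ⟨ihP h.1 _ _, ihQ h.2 _ _⟩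
  | out y zs P ih =>
    obtain rfl : P = .nil := h
    rfl
  | inp y xs P ih | rep y xs P ih =>
    refine ⟨fun hn => ⟨nodup_freshNames _ _, ?_⟩, ih h.2 _ _⟩
    rw [length_freshNames] at hn
    obtain ⟨hx, he⟩ := h.1 hn
    have := he.applySubstAux (updates σ xs (freshNames A xs.length))
      (A ∪ (freshNames A xs.length).toFinset)
    rwa [map_updates (length_freshNames _ _).symm hx] at this

theorem Emits.offers {ws : List Name} {P : Proc} (h : Emits ws P) (σ : Name → Name)
    (A : Finset Name) : Offers (ws.map σ) σ A P := by
  induction P with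
  | out y zs P ih =>
    obtain rfl : zs = ws := h
    rfl
  | par P Q ihP ihQ => exact h.imp ihP ihQ
  | _ => exact h.elim

/-! ## Preservation along reduction -/

theorem IsSummand.eq_of_relays {P S : Proc} (h : IsSummand P S) (hr : Relays S) : P = S := by
  cases h with
  | refl => rfl
  | left => exact hr.elim
  | right => exact hr.elim

theorem LabStep.preserves {P P' : Proc} {a : Option Name} (h : LabStep P a P')
    (hr : Relays P) :
    Relays P' ∧ freeNames (stripMat P') ⊆ freeNames (stripMat P) ∧
      ∀ zs : List Name, (zs.length = 3 ∨ zs.length = 4) → ∀ (σ : Name → Name) (A : Finset Name),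
        Offers zs σ A P → Offers zs σ A P' := by
  induction h with
  | tauStep hs =>
    obtain rfl := hs.eq_of_relays hr
    exact ⟨hr, freeNames_stripMat_subset _, fun _ _ _ _ h => h.elim⟩
  | @com y xs zs P Q S₁ S₂ hl h₁ h₂ =>
    obtain rfl := h₁.eq_of_relays hr.1
    obtain rfl := h₂.eq_of_relays hr.2
    obtain rfl : Q = .nil := hr.2
    refine ⟨⟨hr.1.2.applySubstAux _ _, trivial⟩, ?_, fun ws hw σ A h => ?_⟩
    · have h₁ := freeNames_stripMat_subset (applySubst (updates id xs zs) P)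
      have h₂ := freeNames_applySubst_subset hl P
      simp only [stripMat, freeNames]
      grind
    · rcases h with h | h
      · exact h.elim
      · obtain rfl : zs.map σ = ws := h
        rw [List.length_map, ← hl] at hw
        obtain ⟨hx, he⟩ := hr.1.1 hw
        have := he.applySubstAux (updates id xs zs)
          (allNames P ∪ (allNames P).image (updates id xs zs))
        rw [map_updates hl hx] at this
        exact .inl (this.offers σ A)
  | @repStep y xs zs P Q S hl h₂ =>
    obtain rfl := h₂.eq_of_relays hr.2
    obtain rfl : Q = .nil := hr.2
    refine ⟨⟨hr.1.2.applySubstAux _ _, trivial, hr.1⟩, ?_, fun ws hw σ A h => ?_⟩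
    · have h₁ := freeNames_stripMat_subset (applySubst (updates id xs zs) P)
      have h₂ := freeNames_applySubst_subset hl P
      simp only [stripMat, freeNames]
      grind
    · rcases h with h | h
      · exact h.elim
      · obtain rfl : zs.map σ = ws := h
        rw [List.length_map, ← hl] at hw
        obtain ⟨hx, he⟩ := hr.1.1 hw
        have := he.applySubstAux (updates id xs zs)
          (allNames P ∪ (allNames P).image (updates id xs zs))
        rw [map_updates hl hx] at this
        exact .inl (this.offers σ A)
  | parStep _ ih =>
    obtain ⟨h₁, h₂, h₃⟩ := ih hr.1
    exact ⟨⟨h₁, hr.2⟩, Finset.union_subset_union h₂ subset_rfl,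
      fun zs hz σ A h => h.imp_left (h₃ zs hz σ A)⟩
  | resStep _ ih =>
    obtain ⟨h₁, h₂, h₃⟩ := ih hr
    exact ⟨h₁, Finset.sdiff_subset_sdiff h₂ subset_rfl,
      fun zs hz σ A ⟨x', hx', h⟩ => ⟨x', hx', h₃ zs hz _ _ h⟩⟩
  | congr hP _ hQ ih =>
    obtain ⟨h₁, h₂, h₃⟩ := ih ((StructCong.relays_iff hP).1 hr)
    refine ⟨(StructCong.relays_iff hQ).1 h₁, ?_, fun zs hz σ A h => ?_⟩
    · rwa [StructCong.freeNames_stripMat hP, ← StructCong.freeNames_stripMat hQ]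
    · exact (StructCong.offers_iff hQ).1 (h₃ zs hz σ A ((StructCong.offers_iff hP).1 h))

theorem Steps.preserves {P P' : Proc} (h : Steps P P') (hr : Relays P) :
    Relays P' ∧ freeNames (stripMat P') ⊆ freeNames (stripMat P) ∧
      ∀ zs : List Name, (zs.length = 3 ∨ zs.length = 4) → ∀ (σ : Name → Name) (A : Finset Name),
        Offers zs σ A P → Offers zs σ A P' := by
  induction h with
  | refl => exact ⟨hr, subset_rfl, fun _ _ _ _ h => h⟩
  | tail _ h ih =>
    obtain ⟨h₁, h₂, h₃⟩ := ih
    obtain ⟨a, h⟩ := h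
    obtain ⟨h₁', h₂', h₃'⟩ := h.preserves h₁
    exact ⟨h₁', h₂'.trans h₂, fun zs hz σ A ho => h₃' zs hz σ A (h₃ zs hz σ A ho)⟩

/-! ## Extracting an unguarded output -/

theorem resList_congr {P Q : Proc} (xs : List Name) (h : StructCong P Q) :
    StructCong (resList xs P) (resList xs Q) := by
  induction xs with
  | nil => exact h
  | cons x xs ih => exact .resCong ih

theorem structCong_par_resList {xs : List Name} {P Q : Proc}
    (h : ∀ x ∈ xs, x ∉ freeNames P) :
    StructCong (.par P (resList xs Q)) (resList xs (.par P Q)) := by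
  induction xs with
  | nil => exact .refl
  | cons x xs ih =>
    exact (StructCongX.resPar (h x (by simp))).trans
      (.resCong (ih fun y hy => h y (by simp [hy])))

theorem exists_par_resList {xs zs : List Name} {P Q T : Proc} {p : Name}
    (h : StructCong Q (resList xs (.par T (.out p zs .nil))))
    (hx : ∀ x ∈ xs, x ∉ freeNames P) :
    StructCong (.par P Q) (resList xs (.par (.par P T) (.out p zs .nil))) :=
  ((StructCongX.parCong .refl h).trans (structCong_par_resList hx)).trans
    (resList_congr xs .parAssoc)

theorem Offers.exists_structCong {zs : List Name} {P : Proc} (hr : Relays P)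
    {σ : Name → Name} {A : Finset Name} {π : Equiv.Perm Name}
    (hσ : ∀ n ∈ freeNames P, σ n = π n) (hA : ∀ n ∈ freeNames P, π n ∈ A)
    (h : Offers zs σ A P) :
    ∃ (p : Name) (xs : List Name) (T : Proc), (∀ x ∈ xs, x ∉ A) ∧
      StructCong (renameAll π P) (resList xs (.par T (.out p zs .nil))) := by
  induction P generalizing σ A π with
  | out y ws P ih =>
    obtain rfl : P = .nil := hr
    obtain rfl : ws.map σ = zs := h
    refine ⟨π y, [], .nil, by simp, ?_⟩
    rw [List.map_congr_left fun n hn => hσ n (by simp [freeNames, hn])]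
    exact StructCongX.parNil.symm.trans .parComm
  | mat a b P ih =>
    obtain ⟨rfl, h⟩ := h
    obtain ⟨p, xs, T, hx, hT⟩ := ih hr (fun n hn => hσ n (by simp [freeNames, hn]))
      (fun n hn => hA n (by simp [freeNames, hn])) h
    exact ⟨p, xs, T, hx, StructCongX.matElim.trans hT⟩
  | par P Q ihP ihQ =>
    rcases h with h | h
    · obtain ⟨p, xs, T, hx, hT⟩ := ihP hr.1 (fun n hn => hσ n (by simp [freeNames, hn]))
        (fun n hn => hA n (by simp [freeNames, hn])) h
      refine ⟨p, xs, _, hx, StructCongX.parComm.trans (exists_par_resList hT fun x hxx hc => ?_)⟩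
      rw [freeNames_renameAll π.injective] at hc
      obtain ⟨n, hn, rfl⟩ := Finset.mem_image.1 hc
      exact hx _ hxx (hA n (by simp [freeNames, hn]))
    · obtain ⟨p, xs, T, hx, hT⟩ := ihQ hr.2 (fun n hn => hσ n (by simp [freeNames, hn]))
        (fun n hn => hA n (by simp [freeNames, hn])) h
      refine ⟨p, xs, _, hx, exists_par_resList hT fun x hxx hc => ?_⟩
      rw [freeNames_renameAll π.injective] at hc
      obtain ⟨n, hn, rfl⟩ := Finset.mem_image.1 hc
      exact hx _ hxx (hA n (by simp [freeNames, hn]))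
  | res x P ih =>
    obtain ⟨x', hx', h⟩ := h
    have hne : ∀ n ∈ freeNames P, n ≠ x → (Equiv.swap (π x) x') (π n) = π n := by
      intro n hn hnx
      refine Equiv.swap_apply_of_ne_of_ne (π.injective.ne hnx) ?_
      rintro rfl
      exact hx' (hA n (by simp [freeNames, hn, hnx]))
    have hσ' : ∀ n ∈ freeNames P,
        Function.update σ x x' n = π.trans (Equiv.swap (π x) x') n := by
      intro n hn
      by_cases hnx : n = x
      · simp [hnx]
      · rw [Function.update_of_ne hnx, Equiv.trans_apply, hne n hn hnx]
        exact hσ n (by simp [freeNames, hn, hnx])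
    have hA' : ∀ n ∈ freeNames P, π.trans (Equiv.swap (π x) x') n ∈ insert x' A := by
      intro n hn
      by_cases hnx : n = x
      · simp [hnx]
      · rw [Equiv.trans_apply, hne n hn hnx]
        exact Finset.mem_insert_of_mem (hA n (by simp [freeNames, hn, hnx]))
    obtain ⟨p, xs, T, hx, hT⟩ := ih hr hσ' hA' h
    refine ⟨p, x' :: xs, T, ?_, ?_⟩
    · intro y hy
      rcases List.mem_cons.1 hy with rfl | hy
      · exact hx'
      · exact fun hc => hx y hy (Finset.mem_insert_of_mem hc)
    · refine StructCongX.trans (.alpha (alphaEq_res_swap (x' := x') ?_)) (.resCong ?_)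
      · intro hc
        change x' ∈ freeNames (renameAll π (.res x P)) at hc
        rw [freeNames_renameAll π.injective] at hc
        obtain ⟨n, hn, rfl⟩ := Finset.mem_image.1 hc
        exact hx' (hA n hn)
      · rw [renameAll_comp]
        exact hT
  | _ => exact h.elim

theorem offers_of_structCong {T T' : Proc} {xs zs : List Name} {p : Name}
    (h : StructCong T (resList xs (.par T' (.out p zs .nil)))) :
    Offers zs id (freeNames (stripMat T)) T := by
  rw [StructCong.freeNames_stripMat h, StructCong.offers_iff h]
  refine offers_resList (fun _ _ _ => rfl) fun z _ hz hc => ?_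
  have hfree : ∀ (xs : List Name) (P : Proc), z ∈ xs → z ∉ freeNames (resList xs P) := by
    intro xs P hz
    induction xs with
    | nil => simp at hz
    | cons x xs ih =>
      rcases List.mem_cons.1 hz with rfl | hz
      · simp [resList, freeNames]
      · simp [resList, freeNames, ih hz]
  exact hfree _ _ hz (freeNames_stripMat_subset _ hc)

theorem Steps.exists_structCong {T₁ T₂ T' : Proc} {xs zs : List Name} {p : Name}
    (hr : Relays T₁) (hs : Steps T₁ T₂) (hz : zs.length = 3 ∨ zs.length = 4)
    (h : StructCong T₁ (resList xs (.par T' (.out p zs .nil)))) :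
    ∃ (p' : Name) (xs' : List Name) (T'' : Proc),
      StructCong T₂ (resList xs' (.par T'' (.out p' zs .nil))) := by
  obtain ⟨hr₂, hfn, ho⟩ := hs.preserves hr
  have ho₂ := (ho zs hz _ _ (offers_of_structCong h)).mono (σ' := id) (fun _ _ _ => rfl)
    (fun a ha _ => hfn ha)
  have hstrip := structCong_stripMat T₂
  obtain ⟨p', xs', T'', -, h'⟩ := Offers.exists_structCong (π := 1)
    ((StructCong.relays_iff hstrip).1 hr₂) (fun _ _ => rfl) (fun _ hn => hn)
    ((StructCong.offers_iff hstrip).1 ho₂)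
  rw [Equiv.Perm.coe_one, renameAll_id] at h'
  exact ⟨p', xs', T'', hstrip.trans h'⟩

/-! ## The encoding relays all requests -/

theorem relays_forward (y : Name) {ys : List Name} (h : ys ≠ []) :
    Relays (forward y ys 3) ∧ Relays (forward y ys 4) := by
  have relays : ∀ (zs ys : List Name), Relays (parList (ys.map fun yi => .out yi zs .nil)) := by
    intro zs ys
    induction ys with
    | nil => trivial
    | cons y ys ih =>
      obtain _ | ⟨y', ys⟩ := ys
      · rfl
      · exact ⟨rfl, ih⟩
  have emits : ∀ (zs : List Name), Emits zs (parList (ys.map fun yi => .out yi zs .nil)) := by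
    intro zs
    obtain _ | ⟨y, _ | ⟨y', ys⟩⟩ := ys
    · exact absurd rfl h
    · rfl
    · exact .inl rfl
  exact ⟨⟨fun _ => ⟨by decide, emits _⟩, relays _ _⟩, ⟨fun _ => ⟨by decide, emits _⟩, relays _ _⟩⟩

theorem relays_test {l : Name} {P Q : Proc} :
    Relays (test l P Q) ↔ Relays P ∧ Relays Q := by
  simp [test, Relays]

theorem relays_lockTrue (l : Name) : Relays (lockTrue l) := by
  simp [lockTrue, Relays]

theorem relays_lockFalse (l : Name) : Relays (lockFalse l) := by
  simp [lockFalse, Relays]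

theorem relays_procRightOut : Relays procRightOut := by
  simp [procRightOut, Relays, Emits, relays_forward, nY, nLs, nS, nZ, nY', nLr, nR]

theorem relays_procRightIn : Relays procRightIn := by
  simp [procRightIn, Relays, Emits, relays_forward, nY, nLs, nS, nZ, nY', nLr, nR]

theorem relays_encMApar {P Q : Proc} (hP : Relays P) (hQ : Relays Q) :
    Relays (encMApar P Q) := by
  simp [encMApar, resList, parList, Relays, hP, hQ, procLeftOut, procLeftIn, pushReqs,
    relays_forward, relays_procRightOut, relays_procRightIn]

theorem relays_encMAbranch {P : Proc} (hP : Relays P) : Relays (encMAbranch P) := by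
  simp [encMAbranch, pushReqsIn, pushReqsOut, resList, parList, Relays, hP, relays_forward,
    relays_procRightOut, relays_procRightIn]

theorem relays_encMArep {y x : Name} {P : Proc} (hP : Relays P) :
    Relays (encMArep y [x] P) := by
  simp [encMArep, resList, parList, Relays, relays_encMAbranch hP, relays_test,
    relays_lockTrue, relays_lockFalse]

theorem relays_encMAcore (S : Proc) :
    (IsMix S → Relays (encMAcore S).1) ∧
      (IsMixSum S → Relays (encMAcore S).1 ∧ ∀ l, Relays ((encMAcore S).2 l)) := by
  have mix : ∀ {S : Proc}, (IsMixSum S → Relays (encMAcore S).1 ∧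
      ∀ l, Relays ((encMAcore S).2 l)) → IsMixSum S → Relays (encMAcore S).1 :=
    fun h hs => (h hs).1
  induction S with
  | nil => simp [encMAcore, Relays, relays_lockTrue]
  | succ => exact ⟨fun _ => trivial, nofun⟩
  | res x P ih =>
    refine ⟨fun h => ?_, nofun⟩
    cases h with
    | res h => exact ih.1 h
    | sum h => cases h
  | par P Q ihP ihQ =>
    refine ⟨fun h => ?_, nofun⟩
    cases h with
    | par hP hQ => exact relays_encMApar (ihP.1 hP) (ihQ.1 hQ)
    | sum h => cases h
  | mat a b P ih =>
    refine ⟨fun h => ?_, nofun⟩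
    cases h with
    | mat h => exact ih.1 h
    | sum h => cases h
  | rep y xs P ih =>
    refine ⟨fun h => ?_, nofun⟩
    cases h with
    | rep h => exact relays_encMArep (ih.1 h)
    | sum h => cases h
  | inp y xs P ih =>
    suffices h : _ from ⟨fun | .sum hs => mix h hs, h⟩
    rintro (_ | h)
    simp [encMAcore, Relays, relays_test, relays_lockTrue, relays_lockFalse, ih.1 h]
  | out y xs P ih =>
    suffices h : _ from ⟨fun | .sum hs => mix h hs, h⟩
    rintro (_ | _ | h)
    simp [encMAcore, Relays, relays_lockTrue, ih.1 h]
  | tau P ih =>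
    suffices h : _ from ⟨fun | .sum hs => mix h hs, h⟩
    rintro (_ | _ | _ | h)
    simp [encMAcore, Relays, relays_test, relays_lockTrue, relays_lockFalse, ih.1 h]
  | choice P Q ihP ihQ =>
    suffices h : _ from ⟨fun | .sum hs => mix h hs, h⟩
    rintro (_ | _ | _ | _ | ⟨hP, hQ⟩)
    simp [encMAcore, Relays, relays_lockTrue, (ihP.2 hP).2, (ihQ.2 hQ).2]

theorem TargetMA.relays {T : Proc} (h : TargetMA T) : Relays T := by
  obtain ⟨S, hS, h | h⟩ := h
  · exact (StructCong.relays_iff h).2 ((relays_encMAcore S).1 hS)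
  · exact (h.preserves ((relays_encMAcore S).1 hS)).1

/-- `⟦·⟧ᵐₐ` preserves requests: for all target terms `T₁ ⟹ T₂`, every
unguarded input request `p̄ᵢ⟨y,l,r⟩` of `T₁` persists in `T₂` as an input request on
some request channel `pᵢ'` carrying the same three values; and analogously every
unguarded output request `p̄ₒ⟨y,l,s,z⟩` of `T₁` persists in `T₂` with the same four
values. -/
theorem encMA_preserves_requests :
    (∀ T₁ T₂ : Proc, TargetMA T₁ → TargetMA T₂ → Steps T₁ T₂ →
      ∀ p y l r : Name, hasInputRequest T₁ p y l r →
        ∃ p' : Name, hasInputRequest T₂ p' y l r) ∧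
    (∀ T₁ T₂ : Proc, TargetMA T₁ → TargetMA T₂ → Steps T₁ T₂ →
      ∀ p y l s z : Name, hasOutputRequest T₁ p y l s z →
        ∃ p' : Name, hasOutputRequest T₂ p' y l s z) := by
  constructor
  · rintro T₁ T₂ h₁ - hs p y l r ⟨xs, T', h⟩
    exact hs.exists_structCong h₁.relays (.inl rfl) h
  · rintro T₁ T₂ h₁ - hs p y l s z ⟨xs, T', h⟩
    exact hs.exists_structCong h₁.relays (.inr rfl) h

end PiCalc
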